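/- arXiv:2504.12974 — 4 statements merged into one kernel-verified Lean document; each statement's English description precedes it below -/
import Mathlib

section
/- Let λ₀, μ₀ ∈ ℂ with Im λ₀ > 0 and Im μ₀ > 0, and let z ∈ ℂ with z ≠ λ₀ and z ≠ μ₀. Let T be the 2×2 complex matrix with rows (λ₀, 2i·√(Im λ₀ · Im μ₀)) and (0, μ₀), and let K be the 2×1 complex column matrix with entries √(Im λ₀) and √(Im μ₀). Then 1 − 2i · (Kᴴ * (T − z·1)⁻¹ * K) 0 0 = ((conj λ₀ − z)/(λ₀ − z)) · ((conj μ₀ − z)/(μ₀ − z)); that is, the transfer function of the coupling equals the product of the transfer functions W_{λ₀}(z) = (conj λ₀ − z)/(λ₀ − z) and W_{μ₀}(z) = (conj μ₀ − z)/(μ₀ − z) of the factor L-systems. -/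
open Complex Matrix

theorem stmt_5 (l₀ μ₀ : ℂ) (hl : 0 < l₀.im) (hμ : 0 < μ₀.im)
    (z : ℂ) (hzl : z ≠ l₀) (hzμ : z ≠ μ₀)
    (T : Matrix (Fin 2) (Fin 2) ℂ)
    (hT : T = !![l₀, 2 * I * (Real.sqrt (l₀.im * μ₀.im) : ℂ); 0, μ₀])
    (K : Matrix (Fin 2) (Fin 1) ℂ)
    (hK : K = !![(Real.sqrt l₀.im : ℂ); (Real.sqrt μ₀.im : ℂ)]) :
    1 - 2 * I * ((Kᴴ * (T - z • (1 : Matrix (Fin 2) (Fin 2) ℂ))⁻¹ * K) 0 0)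
      = ((starRingEnd ℂ) l₀ - z) / (l₀ - z) * (((starRingEnd ℂ) μ₀ - z) / (μ₀ - z)) := by
  have ha : l₀ - z ≠ 0 := sub_ne_zero.mpr hzl.symm
  have hd : μ₀ - z ≠ 0 := sub_ne_zero.mpr hzμ.symm
  obtain ⟨p, hp⟩ : ∃ p : ℝ, p = Real.sqrt l₀.im := ⟨_, rfl⟩
  obtain ⟨q, hq⟩ : ∃ q : ℝ, q = Real.sqrt μ₀.im := ⟨_, rfl⟩
  have hp2 : p * p = l₀.im := by rw [hp]; exact Real.mul_self_sqrt hl.le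
  have hq2 : q * q = μ₀.im := by rw [hq]; exact Real.mul_self_sqrt hμ.le
  have hcl : (starRingEnd ℂ) l₀ = l₀ - 2 * I * (p * p : ℂ) := by
    rw [← ofReal_mul, hp2]
    apply Complex.ext <;> simp
    ring
  have hcm : (starRingEnd ℂ) μ₀ = μ₀ - 2 * I * (q * q : ℂ) := by
    rw [← ofReal_mul, hq2]
    apply Complex.ext <;> simp
    ring
  rw [Real.sqrt_mul hl.le, ← hp, ← hq, ofReal_mul] at hT
  rw [← hp, ← hq] at hK
  have hinv : (T - z • (1 : Matrix (Fin 2) (Fin 2) ℂ))⁻¹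
      = !![(l₀ - z)⁻¹, -(2 * I * (p * q : ℂ)) * ((l₀ - z)⁻¹ * (μ₀ - z)⁻¹);
          0, (μ₀ - z)⁻¹] := by
    apply Matrix.inv_eq_right_inv
    rw [hT]
    ext i j
    fin_cases i <;> fin_cases j <;> simp [Matrix.mul_apply, Fin.sum_univ_two, ha, hd]
    field_simp
    ring
  rw [hinv, hcl, hcm, hK]
  simp [Matrix.mul_apply, Fin.sum_univ_two]
  field_simp
  ring_nf
  try simp only [I_sq]
  try ring
end

section
/- Let λ₀, μ₀ ∈ ℂ with Im λ₀ > 0 and Im μ₀ > 0, and let z ∈ ℂ with Im z ≠ 0 (so that in particular (conj λ₀ − z)(conj μ₀ − z) + (λ₀ − z)(μ₀ − z) ≠ 0 and the left side is defined). Let W(z) = ((conj λ₀ − z)/(λ₀ − z)) · ((conj μ₀ − z)/(μ₀ − z)) with z ≠ λ₀, z ≠ μ₀. Then i·(W(z) − 1)/(W(z) + 1) = (Im(λ₀ + μ₀)·z − Im(λ₀·μ₀)) / (Re(λ₀ + μ₀)·z − Re(λ₀·μ₀) − z²), where the real numbers Im(λ₀+μ₀), Im(λ₀μ₀), Re(λ₀+μ₀),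 Re(λ₀μ₀) are coerced to ℂ. -/
open Complex

theorem stmt_6 (l₀ μ₀ : ℂ) (hl : 0 < l₀.im) (hμ : 0 < μ₀.im)
    (z : ℂ) (hz : z.im ≠ 0) (hzl : z ≠ l₀) (hzμ : z ≠ μ₀)
    (W : ℂ → ℂ)
    (hW : W z = ((starRingEnd ℂ) l₀ - z) / (l₀ - z) * (((starRingEnd ℂ) μ₀ - z) / (μ₀ - z))) :
    I * (W z - 1) / (W z + 1)
      = (((l₀ + μ₀).im : ℂ) * z - ((l₀ * μ₀).im : ℂ))
        / (((l₀ + μ₀).re : ℂ) * z - ((l₀ * μ₀).re : ℂ) - z ^ 2) := by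
  have ha : l₀ - z ≠ 0 := sub_ne_zero.mpr hzl.symm
  have hb : μ₀ - z ≠ 0 := sub_ne_zero.mpr hzμ.symm
  have hP : (l₀ - z) * (μ₀ - z) ≠ 0 := mul_ne_zero ha hb
  set N : ℂ := ((l₀ + μ₀).im : ℂ) * z - ((l₀ * μ₀).im : ℂ) with hN
  set D : ℂ := ((l₀ + μ₀).re : ℂ) * z - ((l₀ * μ₀).re : ℂ) - z ^ 2 with hD
  have e1 : ((starRingEnd ℂ) l₀ - z) * ((starRingEnd ℂ) μ₀ - z) - (l₀ - z) * (μ₀ - z)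
      = 2 * I * N := by
    rw [hN]
    apply Complex.ext <;> simp <;> ring
  have e2 : ((starRingEnd ℂ) l₀ - z) * ((starRingEnd ℂ) μ₀ - z) + (l₀ - z) * (μ₀ - z)
      = -2 * D := by
    rw [hD]
    apply Complex.ext <;> simp [pow_two] <;> ring
  have w1 : W z - 1 = 2 * I * N / ((l₀ - z) * (μ₀ - z)) := by
    rw [hW, ← e1]; field_simp
  have w2 : W z + 1 = -2 * D / ((l₀ - z) * (μ₀ - z)) := by
    rw [hW, ← e2]; field_simp
  rw [w1, w2]
  by_cases h : D = 0
  · simp [h]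
  · have h2 : I * (2 * I * N) = -2 * N := by
      linear_combination (2 * N) * I_mul_I
    rw [← mul_div_assoc, h2, div_div_div_cancel_right₀ hP]
    exact mul_div_mul_left N D (by norm_num)
end

section
/- Let a₁, a₂ ∈ ℝ with 0 < a₁ < 1 and 0 < a₂ < 1, and set λ₀ = a₁·i and μ₀ = a₂·i. Let V(z) = (Im(λ₀ + μ₀)·z − Im(λ₀·μ₀)) / (Re(λ₀ + μ₀)·z − Re(λ₀·μ₀) − z²) be the impedance function of the coupling. Then V(i) = a·i where a = (a₁ + a₂)/(1 + a₁·a₂), this a satisfies 0 < a < 1, and (1 − a)/(1 + a) = ((1 − a₁)/(1 + a₁)) · ((1 − a₂)/(1 + a₂)); that is, the coupling impedance belongs to the generalized Donoghue class 𝔐̂_κ with κ = κ₁·κ₂. -/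
open Complex

theorem stmt_7 (a₁ a₂ : ℝ) (ha₁ : 0 < a₁) (ha₁' : a₁ < 1) (ha₂ : 0 < a₂) (ha₂' : a₂ < 1)
    (l₀ μ₀ : ℂ) (hl : l₀ = (a₁ : ℂ) * I) (hμ : μ₀ = (a₂ : ℂ) * I)
    (V : ℂ → ℂ)
    (hV : ∀ z : ℂ, V z = (((l₀ + μ₀).im : ℂ) * z - ((l₀ * μ₀).im : ℂ))
        / (((l₀ + μ₀).re : ℂ) * z - ((l₀ * μ₀).re : ℂ) - z ^ 2))
    (a : ℝ) (ha : a = (a₁ + a₂) / (1 + a₁ * a₂)) :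
    V I = (a : ℂ) * I ∧ 0 < a ∧ a < 1 ∧
      (1 - a) / (1 + a) = ((1 - a₁) / (1 + a₁)) * ((1 - a₂) / (1 + a₂)) := by
  have hp : 0 < 1 + a₁ * a₂ := by positivity
  have ha0 : 0 < a := by rw [ha]; positivity
  refine ⟨?_, ha0, ?_, ?_⟩
  · have h1 : (l₀ + μ₀).im = a₁ + a₂ := by simp [hl, hμ]
    have h2 : (l₀ * μ₀).im = 0 := by simp [hl, hμ]
    have h3 : (l₀ + μ₀).re = 0 := by simp [hl, hμ]
    have h4 : (l₀ * μ₀).re = -(a₁ * a₂) := by simp [hl, hμ]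
    rw [hV, h1, h2, h3, h4, ha, I_sq]
    push_cast
    rw [show (0 : ℂ) * I - -((a₁ : ℂ) * a₂) - -1 = 1 + a₁ * a₂ by ring]
    ring
  · rw [ha, div_lt_one hp]
    nlinarith [mul_pos (sub_pos.2 ha₁') (sub_pos.2 ha₂')]
  · have hx : a * (1 + a₁ * a₂) = a₁ + a₂ := by rw [ha]; field_simp
    have e0 : 1 + a ≠ 0 := by positivity
    have e1 : 1 + a₁ ≠ 0 := by positivity
    have e2 : 1 + a₂ ≠ 0 := by positivity
    rw [div_mul_div_comm, div_eq_div_iff e0 (mul_ne_zero e1 e2)]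
    linear_combination (-2) * hx
end

section
/- Let λ₀ ∈ ℂ with Im λ₀ > 0, let S = −Real.log ‖(conj λ₀ + i)/(λ₀ + i)‖ be the c-entropy of the L-system Θ with parameter λ₀ and D = 1 − Real.exp(−2·S) its dissipation coefficient. Then the coupling 𝚯 = Θ·Θ^×, whose transfer function at −i equals ((conj λ₀ + i)/(λ₀ + i))·((λ₀ − i)/(conj λ₀ − i)), has c-entropy S(𝚯) = −Real.log ‖((conj λ₀ + i)/(λ₀ + i))·((λ₀ − i)/(conj λ₀ − i))‖ = 2·S, and dissipation coefficient D(𝚯) = 1 − Real.exp(−2·S(𝚯)) = 2·D − D². -/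
open Complex

theorem stmt_17 (l₀ : ℂ) (hl : 0 < l₀.im)
    (S D : ℝ)
    (hS : S = -Real.log ‖((starRingEnd ℂ) l₀ + I) / (l₀ + I)‖)
    (hD : D = 1 - Real.exp (-2 * S))
    (Sc Dc : ℝ)
    (hSc : Sc = -Real.log ‖((starRingEnd ℂ) l₀ + I) / (l₀ + I) * ((l₀ - I) / ((starRingEnd ℂ) l₀ - I))‖)
    (hDc : Dc = 1 - Real.exp (-2 * Sc)) :
    Sc = 2 * S ∧ Dc = 2 * D - D ^ 2 := by
  have hc : (l₀ - I) / ((starRingEnd ℂ) l₀ - I)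
      = (starRingEnd ℂ) (((starRingEnd ℂ) l₀ + I) / (l₀ + I)) := by
    simp [sub_eq_add_neg]
  have h1 : Sc = 2 * S := by
    rw [hSc, hS, hc, norm_mul, RCLike.norm_conj, ← pow_two, Real.log_pow]
    push_cast
    ring
  refine ⟨h1, ?_⟩
  have h2 : Real.exp (-2 * Sc) = Real.exp (-2 * S) ^ 2 := by
    rw [h1, pow_two, ← Real.exp_add]
    congr 1
    ring
  rw [hDc, hD, h2]
  ring
end
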